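/- (Left Join Naturalisation.) Let R1 and R2 be relations over attribute sets U1 and U2, and F a filter over U1 ∪ U2. If π_{U1}(R1 ⋈ R2) ⊆ R1, then R1 ⟕_F R2 ≡ ρ^{U2∖U1}_{{u/if(F, u, null) | u ∈ U2∖U1}}(R1 ⟕ R2), i.e., the filtered left join equals the natural left join in which, in each resulting tuple, the value of every attribute u ∈ U2 ∖ U1 is replaced by the value of the term if(F, u, null). -/

import Mathlib

noncomputable section
open Classical

attribute [local instance 10] Classical.propDecidable

namespace RA

variable {A Δ : Type} [DecidableEq A] [DecidableEq Δ]

/-- Three-valued logic: true, false, unknown (error). -/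
inductive TV where
  | tt | ff | unk
deriving DecidableEq

/-- Kleene conjunction. -/
def TV.and : TV → TV → TV
  | .ff, _ => .ff
  | _, .ff => .ff
  | .tt, .tt => .tt
  | _, _ => .unk

/-- Kleene negation. -/
def TV.not : TV → TV
  | .tt => .ff
  | .ff => .tt
  | .unk => .unk

mutual
/-- Terms over attributes `A` and domain `Δ`: attributes, constants and conditionals. -/
inductive Term (A Δ : Type) where
  | attr : A → Term A Δ
  | const : Δ → Term A Δ
  | ite : Filter A Δ → Term A Δ → Term A Δ → Term A Δ

/-- RA filters: `isNull` on a (finite) set of terms, equality, conjunction, negation. -/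
inductive Filter (A Δ : Type) where
  | isNull : List (Term A Δ) → Filter A Δ
  | eq : Term A Δ → Term A Δ → Filter A Δ
  | and : Filter A Δ → Filter A Δ → Filter A Δ
  | not : Filter A Δ → Filter A Δ
end

/-- Disjunction: `F1 ∨ F2 = ¬(¬F1 ∧ ¬F2)`. -/
def Filter.or (F1 F2 : Filter A Δ) : Filter A Δ := .not ((Filter.not F1).and (Filter.not F2))

/-- The tautological filter ⊤ (`isNull` of the empty set of terms is always true). -/
def Filter.tru : Filter A Δ := .isNull []

/-- A tuple over a set of attributes: `none` marks attributes outside the set. -/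
abbrev Tuple (A Δ : Type) := A → Option Δ

mutual
/-- Evaluation of a term on a tuple (`null` is the distinguished null value of `Δ`). -/
def Term.eval (null : Δ) (t : Tuple A Δ) : Term A Δ → Δ
  | .attr a => (t a).getD null
  | .const c => c
  | .ite F v v' => if F.eval null t = TV.tt then v.eval null t else v'.eval null t

def Term.evalList (null : Δ) (t : Tuple A Δ) : List (Term A Δ) → List Δ
  | [] => []
  | v :: vs => v.eval null t :: Term.evalList null t vs

/-- Three-valued evaluation of a filter on a tuple. -/
def Filter.eval (null : Δ) (t : Tuple A Δ) : Filter A Δ → TV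
  | .isNull V => if ∀ d ∈ Term.evalList null t V, d = null then .tt else .ff
  | .eq v v' =>
      if v.eval null t = null ∨ v'.eval null t = null then .unk
      else if v.eval null t = v'.eval null t then .tt else .ff
  | .and F1 F2 => (F1.eval null t).and (F2.eval null t)
  | .not F => (F.eval null t).not
end

mutual
/-- Attributes occurring in a term. -/
def Term.attrs : Term A Δ → Finset A
  | .attr a => {a}
  | .const _ => ∅
  | .ite F v v' => F.attrs ∪ v.attrs ∪ v'.attrs

def Term.attrsList : List (Term A Δ) → Finset A
  | [] => ∅
  | v :: vs => v.attrs ∪ Term.attrsList vs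

/-- Attributes occurring in a filter. -/
def Filter.attrs : Filter A Δ → Finset A
  | .isNull V => Term.attrsList V
  | .eq v v' => v.attrs ∪ v'.attrs
  | .and F1 F2 => F1.attrs ∪ F2.attrs
  | .not F => F.attrs
end

/-- A term is over `U` if all its attributes are in `U`. -/
def Term.over (v : Term A Δ) (U : Finset A) : Prop := v.attrs ⊆ U

/-- A filter is over `U` if all its attributes are in `U`. -/
def Filter.over (F : Filter A Δ) (U : Finset A) : Prop := F.attrs ⊆ U

/-- A tuple is over `U` if its domain is exactly `U`. -/
def Tuple.isOver (t : Tuple A Δ) (U : Finset A) : Prop := ∀ a, (t a).isSome ↔ a ∈ U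

/-- A relation is a bag (multiset) of tuples. -/
abbrev Rel (A Δ : Type) := Multiset (Tuple A Δ)

/-- A relation is over `U` if all its tuples are. -/
def Rel.isOver (R : Rel A Δ) (U : Finset A) : Prop := ∀ t ∈ R, t.isOver U

/-- Selection σ_F. -/
def select (null : Δ) (F : Filter A Δ) (R : Rel A Δ) : Rel A Δ :=
  R.filter (fun t => F.eval null t = .tt)

/-- Restriction of a tuple to the attributes in `U`. -/
def Tuple.restrict (t : Tuple A Δ) (U : Finset A) : Tuple A Δ :=
  fun a => if a ∈ U then t a else none

/-- Projection π_U (bag semantics: multiplicities are added up). -/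
def proj (U : Finset A) (R : Rel A Δ) : Rel A Δ := R.map (·.restrict U)

/-- Bag difference: `(R1 ∖ R2)(t) = R1(t)` if `t ∉ R2` and `0` otherwise. -/
def bdiff (R1 R2 : Rel A Δ) : Rel A Δ := R1.filter (fun t => t ∉ R2)

/-- Compatibility of tuples: equal and non-null on the shared attributes. -/
def Compat (null : Δ) (t1 t2 : Tuple A Δ) : Prop :=
  ∀ a, (t1 a).isSome → (t2 a).isSome → (t1 a = t2 a ∧ t1 a ≠ some null)

/-- `t1 ⊕ t2`: the common extension of two (compatible) tuples. -/
def Tuple.merge (t1 t2 : Tuple A Δ) : Tuple A Δ :=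
  fun a => (t1 a).or (t2 a)

/-- Natural join. -/
def join (null : Δ) (R1 R2 : Rel A Δ) : Rel A Δ :=
  (R1.product R2).filterMap
    (fun p => if Compat null p.1 p.2 then some (p.1.merge p.2) else none)

/-- Natural join with a filter: `R1 ⋈_F R2 = σ_F (R1 ⋈ R2)`. -/
def joinF (null : Δ) (F : Filter A Δ) (R1 R2 : Rel A Δ) : Rel A Δ :=
  select null F (join null R1 R2)

/-- Padding of a tuple with `null` on the attributes of `V`. -/
def Tuple.pad (null : Δ) (V : Finset A) (t : Tuple A Δ) : Tuple A Δ :=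
  fun a => if a ∈ V then (t a).or (some null) else t a

/-- Outer union of `R1` over `U1` and `R2` over `U2`:
each relation is padded with nulls on the attributes missing from it. -/
def ounion (null : Δ) (U1 U2 : Finset A) (R1 R2 : Rel A Δ) : Rel A Δ :=
  R1.map (Tuple.pad null (U2 \ U1)) + R2.map (Tuple.pad null (U1 \ U2))

/-- Left join `R1 ⟕_F R2 = (R1 ⋈_F R2) ⊎ (R1 ∖ π_{U1}(R1 ⋈_F R2))`
for `R1` over `U1` and `R2` over `U2`. -/
def ljoin (null : Δ) (U1 U2 : Finset A) (F : Filter A Δ) (R1 R2 : Rel A Δ) : Rel A Δ :=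
  ounion null (U1 ∪ U2) U1 (joinF null F R1 R2) (bdiff R1 (proj U1 (joinF null F R1 R2)))

/-- Natural left join `R1 ⟕ R2 = R1 ⟕_⊤ R2`. -/
def nljoin (null : Δ) (U1 U2 : Finset A) (R1 R2 : Rel A Δ) : Rel A Δ :=
  ljoin null U1 U2 Filter.tru R1 R2

/-- Extension ν_{u↦v}. -/
def extend (null : Δ) (u : A) (v : Term A Δ) (R : Rel A Δ) : Rel A Δ :=
  R.map (fun t a => if a = u then some (v.eval null t) else t a)

/-- Duplicate elimination δ. -/
def dedup (R : Rel A Δ) : Rel A Δ := R.dedup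

/-- Extended renaming ρ^V_{{u/f(u) | u ∈ S}} at the level of tuples:
each attribute `u ∈ S` receives the value of the term `f u` (evaluated on the original
tuple) and the attributes of `V ∖ S` are projected away. -/
def renameFun (null : Δ) (V S : Finset A) (f : A → Term A Δ) (t : Tuple A Δ) : Tuple A Δ :=
  fun a => if a ∈ S then some ((f a).eval null t) else if a ∈ V then none else t a

/-- Extended renaming ρ^V_{{u/f(u) | u ∈ S}}. -/
def rename (null : Δ) (V S : Finset A) (f : A → Term A Δ) (R : Rel A Δ) : Rel A Δ :=
  R.map (renameFun null V S f)

/-- Renaming of the attribute `uold` into `unew` at the level of tuples. -/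
def renameAttrT (unew uold : A) (t : Tuple A Δ) : Tuple A Δ :=
  fun a => if a = unew then t uold else if a = uold then none else t a

/-- `R[unew/uold]`: the relation `R` with the attribute `uold` renamed to `unew`. -/
def renameAttr (unew uold : A) (R : Rel A Δ) : Rel A Δ := R.map (renameAttrT unew uold)

/-- `coalesce(v, v') = if(¬isNull(v), v, v')`. -/
def Term.coalesce (v v' : Term A Δ) : Term A Δ := .ite (.not (.isNull [v])) v v'

/-- The filter `⋀_{u ∈ K} ¬isNull(u)`. -/
def notNullAll (K : Finset A) : Filter A Δ :=
  K.toList.foldr (fun u acc => (Filter.not (.isNull [.attr u])).and acc) Filter.tru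

mutual
/-- `nullify_S`: replace every occurrence of an attribute from `S` by the constant null. -/
def Term.nullify (null : Δ) (S : Finset A) : Term A Δ → Term A Δ
  | .attr a => if a ∈ S then .const null else .attr a
  | .const c => .const c
  | .ite F v v' => .ite (F.nullify null S) (v.nullify null S) (v'.nullify null S)

def Term.nullifyList (null : Δ) (S : Finset A) : List (Term A Δ) → List (Term A Δ)
  | [] => []
  | v :: vs => v.nullify null S :: Term.nullifyList null S vs

/-- `nullify_S` on filters. -/
def Filter.nullify (null : Δ) (S : Finset A) : Filter A Δ → Filter A Δ
  | .isNull V => .isNull (Term.nullifyList null S V)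
  | .eq v v' => .eq (v.nullify null S) (v'.nullify null S)
  | .and F1 F2 => .and (F1.nullify null S) (F2.nullify null S)
  | .not F => .not (F.nullify null S)
end

/-- p-equivalence of filters over `U`: they are ⊤ on the same tuples over `U`. -/
def pequiv (null : Δ) (U : Finset A) (F1 F2 : Filter A Δ) : Prop :=
  ∀ t : Tuple A Δ, t.isOver U → (F1.eval null t = TV.tt ↔ F2.eval null t = TV.tt)

end RA

namespace RA

section

variable {A Δ : Type}

theorem Tuple.isOver.eq_none {t : Tuple A Δ} {U : Finset A} (h : t.isOver U) {a : A}
    (ha : a ∉ U) : t a = none := by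
  rw [← h a] at ha
  simpa using ha

theorem Tuple.isOver.exists_eq_some {t : Tuple A Δ} {U : Finset A} (h : t.isOver U) {a : A}
    (ha : a ∈ U) : ∃ d, t a = some d :=
  Option.isSome_iff_exists.1 ((h a).2 ha)

theorem join_eq_bind (null : Δ) (R1 R2 : Rel A Δ) :
    join null R1 R2 = R1.bind fun t1 => (R2.filter (Compat null t1)).map t1.merge := by
  rw [join, Multiset.product, Multiset.filterMap_bind]
  refine Multiset.bind_congr fun t1 _ => ?_
  rw [Multiset.filterMap_map, Multiset.map_filter_eq_filterMap]
  rfl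

theorem count_bind_replicate {α : Type*} [DecidableEq α] (s : Multiset α) (k : α → ℕ) (a : α) :
    (s.bind fun b => Multiset.replicate (k b) b).count a = s.count a * k a := by
  induction s using Multiset.induction_on with
  | empty => simp
  | cons b s ih =>
    rw [Multiset.cons_bind, Multiset.count_add, ih, Multiset.count_replicate, Multiset.count_cons]
    by_cases h : a = b
    · subst h
      simp [add_mul, add_comm]
    · simp [h, Ne.symm h]

/-- The number of join partners of `t` in `R` for which the joined tuple satisfies `P`. -/
def partners (null : Δ) (P : Tuple A Δ → Prop) [DecidablePred P] (R : Rel A Δ)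
    (t : Tuple A Δ) : ℕ :=
  ((R.filter (Compat null t)).filter fun t' => P (t.merge t')).card

theorem partners_add_partners_not (null : Δ) (P : Tuple A Δ → Prop) [DecidablePred P] (R : Rel A Δ)
    (t : Tuple A Δ) : partners null P R t + partners null (fun s => ¬ P s) R t =
      partners null (fun _ => True) R t := by
  simp only [partners, Multiset.filter_true]
  rw [← Multiset.card_add, Multiset.filter_add_not]

theorem select_tru [DecidableEq Δ] (null : Δ) (R : Rel A Δ) : select null Filter.tru R = R := by
  simp [select, Filter.tru, Filter.eval, Term.evalList]

variable [DecidableEq A]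

theorem Tuple.isOver.merge {t1 t2 : Tuple A Δ} {U1 U2 : Finset A} (h1 : t1.isOver U1)
    (h2 : t2.isOver U2) : (t1.merge t2).isOver (U1 ∪ U2) := by
  intro a
  simp only [Tuple.merge, Option.isSome_or, Bool.or_eq_true, h1 a, h2 a, Finset.mem_union]

theorem Tuple.restrict_merge {t1 t2 : Tuple A Δ} {U1 : Finset A} (h1 : t1.isOver U1) :
    (t1.merge t2).restrict U1 = t1 := by
  funext a
  by_cases ha : a ∈ U1
  · obtain ⟨d, hd⟩ := h1.exists_eq_some ha
    simp [Tuple.restrict, Tuple.merge, ha, hd]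
  · simp [Tuple.restrict, ha, h1.eq_none ha]

theorem Tuple.pad_empty (null : Δ) (t : Tuple A Δ) : t.pad null ∅ = t := by
  funext a
  simp [Tuple.pad]

theorem isOver_join (null : Δ) {U1 U2 : Finset A} {R1 R2 : Rel A Δ} (h1 : R1.isOver U1)
    (h2 : R2.isOver U2) : (join null R1 R2).isOver (U1 ∪ U2) := by
  intro t ht
  simp only [join_eq_bind, Multiset.mem_bind, Multiset.mem_map, Multiset.mem_filter] at ht
  obtain ⟨t1, ht1, t2, ⟨ht2, -⟩, rfl⟩ := ht
  exact (h1 t1 ht1).merge (h2 t2 ht2)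

theorem count_proj_filter_join (null : Δ) {U1 : Finset A} {R1 : Rel A Δ} (R2 : Rel A Δ)
    (h1 : R1.isOver U1) (P : Tuple A Δ → Prop) [DecidablePred P] (t : Tuple A Δ) :
    (proj U1 ((join null R1 R2).filter P)).count t = R1.count t * partners null P R2 t := by
  rw [← count_bind_replicate, join_eq_bind, Multiset.filter_bind, proj, Multiset.map_bind]
  congr 1
  refine Multiset.bind_congr fun t1 ht1 => ?_
  rw [Multiset.filter_map, Multiset.map_map]
  have : (fun t : Tuple A Δ => t.restrict U1) ∘ t1.merge = fun _ => t1 :=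
    funext fun t2 => Tuple.restrict_merge (h1 t1 ht1)
  rw [this, Multiset.map_const']
  rfl

/-- If the join adds no copies of tuples of `R1`, the tuples of `R1` without partner passing `P`
are those without any partner and those whose only partner fails `P`. -/
theorem bdiff_proj_filter_join (null : Δ) {U1 : Finset A} {R1 R2 : Rel A Δ}
    (h1 : R1.isOver U1) (hsub : proj U1 (join null R1 R2) ≤ R1) (P : Tuple A Δ → Prop)
    [DecidablePred P] :
    bdiff R1 (proj U1 ((join null R1 R2).filter P)) =
      proj U1 ((join null R1 R2).filter fun t => ¬ P t) +
        bdiff R1 (proj U1 (join null R1 R2)) := by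
  ext t
  have hall := count_proj_filter_join null R2 h1 (fun _ => True) t
  simp only [Multiset.filter_true] at hall
  have hle := Multiset.count_le_of_le t hsub
  have hP := count_proj_filter_join null R2 h1 P t
  have hN := count_proj_filter_join null R2 h1 (fun s => ¬ P s) t
  have hadd := partners_add_partners_not null P R2 t
  rw [hall] at hle
  simp only [Multiset.count_add, hN, bdiff, Multiset.count_filter, ← Multiset.count_eq_zero, hP,
    hall, ← hadd]
  rw [← hadd] at hle
  rcases Nat.eq_zero_or_pos (R1.count t) with h0 | h0
  · simp [h0]
  · have hle' := Nat.le_of_mul_le_mul_left (hle.trans_eq (mul_one _).symm) h0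
    generalize partners null P R2 t = m at *
    generalize partners null (fun s => ¬ P s) R2 t = n at *
    have : (m = 0 ∧ n = 0) ∨ (m = 0 ∧ n = 1) ∨ (m = 1 ∧ n = 0) := by omega
    rcases this with ⟨rfl, rfl⟩ | ⟨rfl, rfl⟩ | ⟨rfl, rfl⟩ <;> simp [h0.ne']

variable [DecidableEq Δ]

section RenameFun

variable {null : Δ} {U1 U2 : Finset A} {F : Filter A Δ} {t : Tuple A Δ}

theorem renameFun_ite_of_eval_eq (ht : t.isOver (U1 ∪ U2)) (hF : F.eval null t = .tt) :
    renameFun null (U2 \ U1) (U2 \ U1) (fun u => .ite F (.attr u) (.const null)) t = t := by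
  funext a
  by_cases ha : a ∈ U2 \ U1
  · obtain ⟨d, hd⟩ := ht.exists_eq_some
      (Finset.mem_union_right U1 (Finset.mem_sdiff.1 ha).1)
    simp [renameFun, ha, Term.eval, hF, hd]
  · simp [renameFun, ha]

theorem renameFun_ite_of_eval_ne (ht : t.isOver (U1 ∪ U2)) (hF : F.eval null t ≠ .tt) :
    renameFun null (U2 \ U1) (U2 \ U1) (fun u => .ite F (.attr u) (.const null)) t =
      (t.restrict U1).pad null (U2 \ U1) := by
  funext a
  by_cases ha : a ∈ U2 \ U1
  · have ha1 := (Finset.mem_sdiff.1 ha).2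
    simp [renameFun, ha, Term.eval, hF, Tuple.pad, Tuple.restrict, ha1]
  · by_cases ha1 : a ∈ U1
    · simp [renameFun, ha1, Tuple.pad, Tuple.restrict]
    · have : a ∉ U2 := fun h => ha (Finset.mem_sdiff.2 ⟨h, ha1⟩)
      simp [renameFun, this, Tuple.pad, Tuple.restrict, ha1, ht.eq_none (a := a)]

theorem renameFun_ite_pad (ht : t.isOver U1) :
    renameFun null (U2 \ U1) (U2 \ U1) (fun u => .ite F (.attr u) (.const null))
      (t.pad null (U2 \ U1)) = t.pad null (U2 \ U1) := by
  funext a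
  by_cases ha : a ∈ U2 \ U1
  · have := ht.eq_none (Finset.mem_sdiff.1 ha).2
    simp [renameFun, ha, Term.eval, Tuple.pad, this]
  · simp [renameFun, ha]

end RenameFun

theorem ljoin_eq (null : Δ) (U1 U2 : Finset A) (F : Filter A Δ) (R1 R2 : Rel A Δ) :
    ljoin null U1 U2 F R1 R2 = select null F (join null R1 R2) +
      (bdiff R1 (proj U1 (select null F (join null R1 R2)))).map (Tuple.pad null (U2 \ U1)) := by
  rw [ljoin, ounion, Finset.sdiff_eq_empty_iff_subset.2 Finset.subset_union_left,
    Finset.union_sdiff_left, joinF, funext (Tuple.pad_empty null), Multiset.map_id']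

end

end RA

namespace RA

variable {A Δ : Type} [DecidableEq A] [DecidableEq Δ]

theorem stmt9 (null : Δ) (U1 U2 : Finset A) (R1 R2 : Rel A Δ) (F : Filter A Δ)
    (hR1 : R1.isOver U1) (hR2 : R2.isOver U2) (hF : F.over (U1 ∪ U2))
    (hsub : proj U1 (join null R1 R2) ≤ R1) :
    ljoin null U1 U2 F R1 R2
      = rename null (U2 \ U1) (U2 \ U1) (fun u => .ite F (.attr u) (.const null))
          (nljoin null U1 U2 R1 R2) := by
  have hJ := isOver_join null hR1 hR2
  have hsel : select null F (join null R1 R2) =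
      (join null R1 R2).filter fun t => F.eval null t = .tt :=
    Multiset.filter_congr fun _ _ => Iff.rfl
  rw [nljoin, ljoin_eq, ljoin_eq, select_tru, hsel, bdiff_proj_filter_join null hR1 hsub, rename,
    Multiset.map_add, Multiset.map_add, Multiset.map_map, ← add_assoc]
  congr 1
  · conv_rhs => rw [← Multiset.filter_add_not (fun t => F.eval null t = .tt) (join null R1 R2)]
    rw [Multiset.map_add, proj, Multiset.map_map]
    congr 1
    · conv_lhs => rw [← Multiset.map_id ((join null R1 R2).filter fun t => F.eval null t = .tt)]
      refine Multiset.map_congr rfl fun t ht => ?_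
      rw [Multiset.mem_filter] at ht
      exact (renameFun_ite_of_eval_eq (hJ t ht.1) ht.2).symm
    · refine Multiset.map_congr rfl fun t ht => ?_
      rw [Multiset.mem_filter] at ht
      exact (renameFun_ite_of_eval_ne (hJ t ht.1) ht.2).symm
  · refine Multiset.map_congr rfl fun t ht => ?_
    exact (renameFun_ite_pad (hR1 t (Multiset.mem_filter.1 ht).1)).symm

end RA
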